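/- For every x ∈ [0,1], Σ_{k≥1} x^{2k}/(2k(2k-1)) = ((1+x)log(1+x) + (1-x)log(1-x))/2. -/

import Mathlib

theorem hasSum_binEnt_of_abs_lt_one {x : ℝ} (hx : |x| < 1) :
    HasSum (fun n : ℕ => x ^ (2 * (n + 1)) / ((2 * (n : ℝ) + 2) * (2 * (n : ℝ) + 1)))
      (((1 + x) * Real.log (1 + x) + (1 - x) * Real.log (1 - x)) / 2) := by
  obtain ⟨hneg, hpos⟩ := abs_lt.mp hx
  have hsq : |x ^ 2| < 1 := by
    rw [abs_pow]
    exact pow_lt_one₀ (abs_nonneg x) hx two_ne_zero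
  have hodd := (Real.hasSum_log_sub_log_of_abs_lt_one hx).mul_left (x / 2)
  have heven := (Real.hasSum_pow_div_log_of_abs_lt_one hsq).mul_left (1 / 2)
  have hlog : Real.log (1 - x ^ 2) = Real.log (1 + x) + Real.log (1 - x) := by
    rw [← Real.log_mul (by linarith) (by linarith)]
    ring_nf
  have hval : ((1 + x) * Real.log (1 + x) + (1 - x) * Real.log (1 - x)) / 2 =
      x / 2 * (Real.log (1 + x) - Real.log (1 - x)) - 1 / 2 * -Real.log (1 - x ^ 2) := by
    rw [hlog]
    ring
  rw [hval]
  refine (hodd.sub heven).congr_fun fun n => ?_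
  have h₁ : (n : ℝ) + 1 ≠ 0 := by positivity
  have h₂ : 2 * (n : ℝ) + 1 ≠ 0 := by positivity
  have h₃ : 2 * (n : ℝ) + 2 ≠ 0 := by positivity
  rw [← pow_mul]
  field_simp
  ring

theorem summable_one_div_two_mul_add_two_mul_two_mul_add_one :
    Summable fun n : ℕ => 1 / ((2 * (n : ℝ) + 2) * (2 * (n : ℝ) + 1)) := by
  refine Summable.of_nonneg_of_le (fun n => by positivity) (fun n => ?_)
    ((summable_nat_add_iff 1).mpr (Real.summable_one_div_nat_pow.mpr one_lt_two))
  have hn : (0 : ℝ) ≤ n := n.cast_nonneg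
  push_cast
  exact one_div_le_one_div_of_le (by positivity) (by nlinarith)

theorem continuousOn_tsum_binEnt :
    ContinuousOn (fun x : ℝ =>
      ∑' n : ℕ, x ^ (2 * (n + 1)) / ((2 * (n : ℝ) + 2) * (2 * (n : ℝ) + 1)))
      (Set.Icc 0 1) := by
  refine continuousOn_tsum (fun n => by fun_prop)
    summable_one_div_two_mul_add_two_mul_two_mul_add_one fun n x hx => ?_
  have hx₀ := hx.1
  rw [Real.norm_of_nonneg (by positivity)]
  gcongr
  exact pow_le_one₀ hx.1 hx.2

theorem binEnt_power_series :
    ∀ x ∈ Set.Icc (0 : ℝ) 1,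
      ∑' n : ℕ, x ^ (2 * (n + 1)) / ((2 * (n : ℝ) + 2) * (2 * (n : ℝ) + 1))
        = ((1 + x) * Real.log (1 + x) + (1 - x) * Real.log (1 - x)) / 2 := by
  have hcont : Continuous fun x : ℝ =>
      ((1 + x) * Real.log (1 + x) + (1 - x) * Real.log (1 - x)) / 2 :=
    ((Real.continuous_mul_log.comp (continuous_const.add continuous_id)).add
      (Real.continuous_mul_log.comp (continuous_const.sub continuous_id))).div_const 2
  have heq : Set.EqOn (fun x : ℝ =>
      ∑' n : ℕ, x ^ (2 * (n + 1)) / ((2 * (n : ℝ) + 2) * (2 * (n : ℝ) + 1)))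
      (fun x => ((1 + x) * Real.log (1 + x) + (1 - x) * Real.log (1 - x)) / 2)
      (Set.Ico 0 1) := fun x hx =>
    (hasSum_binEnt_of_abs_lt_one (abs_lt.mpr ⟨by linarith [hx.1], hx.2⟩)).tsum_eq
  exact heq.of_subset_closure continuousOn_tsum_binEnt hcont.continuousOn
    Set.Ico_subset_Icc_self (closure_Ico zero_ne_one).ge
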